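/- Let n ≥ 4 and let y ∈ S_n satisfy y^{-1}(2) < y^{-1}(3) < ⋯ < y^{-1}(n−2) and y^{-1}(n−1) < y^{-1}(n). If n is odd, the elements c, c s_{n−2}s_{n−3}, …, c s_{n−2}⋯s_2, c s_{n−2}⋯s_2 s_3 s_4, …, c s_{n−2}⋯s_2 s_3 s_4⋯s_{n−2}s_{n−1} are all n-cycles, where c = s_{n−2}s_{n−1}s_{n−3}⋯s_2 s_1; the analogous list with c s_{n−2}⋯s_3 s_2 s_3⋯s_{n−2}s_{n−1} holds for n even. In particular, for each 1 ≤ j ≤ n−2 there exist at least j distinct n-cycles y of Coxeter length 3n−2j−5 in S_n satisfying the displayed inequalities. -/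

import Mathlib

/-- The simple transposition s_j = (j, j+1) on ℕ. -/
def simpleRefl (j : ℕ) : Equiv.Perm ℕ := Equiv.swap j (j + 1)

/-- c = s_{n−2} s_{n−1} s_{n−3} ⋯ s_2 s_1. -/
def cElt (n : ℕ) : Equiv.Perm ℕ :=
  (((n - 2) :: (n - 1) :: (List.range' 1 (n - 3)).reverse).map simpleRefl).prod

/-- c · s_{n−2} s_{n−3} ⋯ s_k. -/
def descElt (n k : ℕ) : Equiv.Perm ℕ :=
  cElt n * ((List.range' k (n - 1 - k)).reverse.map simpleRefl).prod

/-- p is an n-cycle (a cycle moving exactly n points). -/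
def IsNCycleOn (n : ℕ) (p : Equiv.Perm ℕ) : Prop :=
  p.IsCycle ∧ {a : ℕ | p a ≠ a}.ncard = n

/-- The Coxeter length of y ∈ S_n: the number of inversions among 1 ≤ a < b ≤ n. -/
def coxLen (n : ℕ) (y : Equiv.Perm ℕ) : ℕ :=
  ((Finset.Icc 1 n ×ˢ Finset.Icc 1 n).filter fun p => p.1 < p.2 ∧ y p.2 < y p.1).card

/-- One-line form, type A: value `1` at `p`, `n-1` at `i`, `n` at `i+1`, with `p > i+1`. -/
def fA (n i p a : ℕ) : ℕ :=
  if a = 0 ∨ n < a then a else if a < i then a + 1 else if a = i then n - 1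
  else if a = i + 1 then n else if a < p then a - 1 else if a = p then 1 else a - 2

/-- Inverse of `fA`. -/
def gA (n i p b : ℕ) : ℕ :=
  if b = 0 ∨ n < b then b else if b = 1 then p else if b = n - 1 then i
  else if b = n then i + 1 else if b ≤ i then b - 1 else if b + 2 ≤ p then b + 1 else b + 2

/-- One-line form, type B: value `1` at `i+1`, `n-1` at `i`, `n` at `r`, with `r > i+1`. -/
def fB (n i r a : ℕ) : ℕ :=
  if a = 0 ∨ n < a then a else if a < i then a + 1 else if a = i then n - 1
  else if a = i + 1 then 1 else if a < r then a - 1 else if a = r then n else a - 2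

/-- Inverse of `fB`. -/
def gB (n i r b : ℕ) : ℕ :=
  if b = 0 ∨ n < b then b else if b = 1 then i + 1 else if b = n - 1 then i
  else if b = n then r else if b ≤ i then b - 1 else if b + 2 ≤ r then b + 1 else b + 2

theorem fA_spec (n i p a : ℕ) : ((a = 0 ∨ n < a) ∧ fA n i p a = a) ∨ (1 ≤ a ∧ a ≤ n ∧
    ((a < i ∧ fA n i p a = a + 1) ∨ (a = i ∧ fA n i p a = n - 1) ∨
     (a = i + 1 ∧ fA n i p a = n) ∨ (i + 1 < a ∧ a < p ∧ fA n i p a = a - 1) ∨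
     (i + 1 < a ∧ a = p ∧ fA n i p a = 1) ∨ (i + 1 < a ∧ p < a ∧ fA n i p a = a - 2))) := by
  unfold fA
  by_cases h0 : a = 0 ∨ n < a
  · rw [if_pos h0]; exact Or.inl ⟨h0, rfl⟩
  rw [if_neg h0]
  refine Or.inr ⟨by omega, by omega, ?_⟩
  by_cases h1 : a < i
  · rw [if_pos h1]; exact Or.inl ⟨h1, rfl⟩
  rw [if_neg h1]
  by_cases h2 : a = i
  · rw [if_pos h2]; exact Or.inr (Or.inl ⟨h2, rfl⟩)
  rw [if_neg h2]
  by_cases h3 : a = i + 1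
  · rw [if_pos h3]; exact Or.inr (Or.inr (Or.inl ⟨h3, rfl⟩))
  rw [if_neg h3]
  have h3' : i + 1 < a := by omega
  by_cases h4 : a < p
  · rw [if_pos h4]; exact Or.inr (Or.inr (Or.inr (Or.inl ⟨h3', h4, rfl⟩)))
  rw [if_neg h4]
  by_cases h5 : a = p
  · rw [if_pos h5]; exact Or.inr (Or.inr (Or.inr (Or.inr (Or.inl ⟨h3', h5, rfl⟩))))
  rw [if_neg h5]
  exact Or.inr (Or.inr (Or.inr (Or.inr (Or.inr ⟨h3', by omega, rfl⟩))))

theorem gA_spec (n i p a : ℕ) : ((a = 0 ∨ n < a) ∧ gA n i p a = a) ∨ (1 ≤ a ∧ a ≤ n ∧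
    ((a = 1 ∧ gA n i p a = p) ∨ (a ≠ 1 ∧ ((a = n - 1 ∧ gA n i p a = i) ∨
     (a ≠ n - 1 ∧ a = n ∧ gA n i p a = i + 1) ∨
     (a + 2 ≤ n ∧ ((a ≤ i ∧ gA n i p a = a - 1) ∨
     (i < a ∧ a + 2 ≤ p ∧ gA n i p a = a + 1) ∨
     (i < a ∧ p < a + 2 ∧ gA n i p a = a + 2))))))) := by
  unfold gA
  by_cases h0 : a = 0 ∨ n < a
  · rw [if_pos h0]; omega
  rw [if_neg h0]
  by_cases h1 : a = 1
  · rw [if_pos h1]; omega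
  rw [if_neg h1]
  by_cases h2 : a = n - 1
  · rw [if_pos h2]; omega
  rw [if_neg h2]
  by_cases h3 : a = n
  · rw [if_pos h3]; omega
  rw [if_neg h3]
  by_cases h4 : a ≤ i
  · rw [if_pos h4]; omega
  rw [if_neg h4]
  by_cases h5 : a + 2 ≤ p
  · rw [if_pos h5]; omega
  rw [if_neg h5]; omega

theorem fB_spec (n i p a : ℕ) : ((a = 0 ∨ n < a) ∧ fB n i p a = a) ∨ (1 ≤ a ∧ a ≤ n ∧
    ((a < i ∧ fB n i p a = a + 1) ∨ (a = i ∧ fB n i p a = n - 1) ∨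
     (a = i + 1 ∧ fB n i p a = 1) ∨ (i + 1 < a ∧ a < p ∧ fB n i p a = a - 1) ∨
     (i + 1 < a ∧ a = p ∧ fB n i p a = n) ∨ (i + 1 < a ∧ p < a ∧ fB n i p a = a - 2))) := by
  unfold fB
  by_cases h0 : a = 0 ∨ n < a
  · rw [if_pos h0]; exact Or.inl ⟨h0, rfl⟩
  rw [if_neg h0]
  refine Or.inr ⟨by omega, by omega, ?_⟩
  by_cases h1 : a < i
  · rw [if_pos h1]; exact Or.inl ⟨h1, rfl⟩
  rw [if_neg h1]
  by_cases h2 : a = i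
  · rw [if_pos h2]; exact Or.inr (Or.inl ⟨h2, rfl⟩)
  rw [if_neg h2]
  by_cases h3 : a = i + 1
  · rw [if_pos h3]; exact Or.inr (Or.inr (Or.inl ⟨h3, rfl⟩))
  rw [if_neg h3]
  have h3' : i + 1 < a := by omega
  by_cases h4 : a < p
  · rw [if_pos h4]; exact Or.inr (Or.inr (Or.inr (Or.inl ⟨h3', h4, rfl⟩)))
  rw [if_neg h4]
  by_cases h5 : a = p
  · rw [if_pos h5]; exact Or.inr (Or.inr (Or.inr (Or.inr (Or.inl ⟨h3', h5, rfl⟩))))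
  rw [if_neg h5]
  exact Or.inr (Or.inr (Or.inr (Or.inr (Or.inr ⟨h3', by omega, rfl⟩))))

theorem gB_spec (n i p a : ℕ) : ((a = 0 ∨ n < a) ∧ gB n i p a = a) ∨ (1 ≤ a ∧ a ≤ n ∧
    ((a = 1 ∧ gB n i p a = i + 1) ∨ (a ≠ 1 ∧ ((a = n - 1 ∧ gB n i p a = i) ∨
     (a ≠ n - 1 ∧ a = n ∧ gB n i p a = p) ∨
     (a + 2 ≤ n ∧ ((a ≤ i ∧ gB n i p a = a - 1) ∨
     (i < a ∧ a + 2 ≤ p ∧ gB n i p a = a + 1) ∨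
     (i < a ∧ p < a + 2 ∧ gB n i p a = a + 2))))))) := by
  unfold gB
  by_cases h0 : a = 0 ∨ n < a
  · rw [if_pos h0]; omega
  rw [if_neg h0]
  by_cases h1 : a = 1
  · rw [if_pos h1]; omega
  rw [if_neg h1]
  by_cases h2 : a = n - 1
  · rw [if_pos h2]; omega
  rw [if_neg h2]
  by_cases h3 : a = n
  · rw [if_pos h3]; omega
  rw [if_neg h3]
  by_cases h4 : a ≤ i
  · rw [if_pos h4]; omega
  rw [if_neg h4]
  by_cases h5 : a + 2 ≤ p
  · rw [if_pos h5]; omega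
  rw [if_neg h5]; omega

theorem sr_spec (j a : ℕ) : (a = j ∧ simpleRefl j a = j + 1) ∨ (a = j + 1 ∧ simpleRefl j a = j) ∨
    (a ≠ j ∧ a ≠ j + 1 ∧ simpleRefl j a = a) := by
  unfold simpleRefl
  by_cases h1 : a = j
  · subst h1; simp
  by_cases h2 : a = j + 1
  · subst h2; simp
  rw [Equiv.swap_apply_of_ne_of_ne h1 h2]
  exact Or.inr (Or.inr ⟨h1, h2, rfl⟩)

theorem exists_A (n i p : ℕ) (hn : 4 ≤ n) (hi : 1 ≤ i) (hp : i + 2 ≤ p) (hpn : p ≤ n) :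
    ∃ z : Equiv.Perm ℕ, (∀ a, z a = fA n i p a) ∧ ∀ b, z⁻¹ b = gA n i p b := by
  refine ⟨⟨fA n i p, gA n i p, ?_, ?_⟩, fun _ => rfl, fun _ => rfl⟩
  · intro a
    have h1 := fA_spec n i p a
    have h2 := gA_spec n i p (fA n i p a)
    omega
  · intro a
    have h1 := gA_spec n i p a
    have h2 := fA_spec n i p (gA n i p a)
    omega

theorem exists_B (n i p : ℕ) (hn : 4 ≤ n) (hi : 1 ≤ i) (hp : i + 2 ≤ p) (hpn : p + 1 ≤ n) :
    ∃ z : Equiv.Perm ℕ, (∀ a, z a = fB n i p a) ∧ ∀ b, z⁻¹ b = gB n i p b := by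
  refine ⟨⟨fB n i p, gB n i p, ?_, ?_⟩, fun _ => rfl, fun _ => rfl⟩
  · intro a
    have h1 := fB_spec n i p a
    have h2 := gB_spec n i p (fB n i p a)
    omega
  · intro a
    have h1 := gB_spec n i p a
    have h2 := fB_spec n i p (gB n i p a)
    omega

theorem same_step (z : Equiv.Perm ℕ) (a b : ℕ) (h : z a = b) : z.SameCycle a b :=
  ⟨1, by simpa using h⟩

/-- ascending chain -/
theorem chain_up (z : Equiv.Perm ℕ) (d s : ℕ) (m : ℕ)
    (h : ∀ k < m, z (s + d * k) = s + d * (k + 1)) : z.SameCycle s (s + d * m) := by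
  induction m with
  | zero => simp; exact Equiv.Perm.SameCycle.refl _ _
  | succ m ih => exact (ih fun k hk => h k (by omega)).trans (same_step z _ _ (h m (by omega)))

/-- descending chain -/
theorem chain_down (z : Equiv.Perm ℕ) (d s : ℕ) (m : ℕ)
    (h : ∀ k < m, z (s + d * (k + 1)) = s + d * k) : z.SameCycle s (s + d * m) := by
  induction m with
  | zero => simp; exact Equiv.Perm.SameCycle.refl _ _
  | succ m ih =>
    exact (ih fun k hk => h k (by omega)).trans (same_step z _ _ (h m (by omega))).symm

theorem isNCycleOn_of (n : ℕ) (hn : 4 ≤ n) (z : Equiv.Perm ℕ)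
    (hfix : ∀ a, (a = 0 ∨ n < a) → z a = a) (hmv : ∀ a, 1 ≤ a → a ≤ n → z a ≠ a)
    (hs : ∀ a, 1 ≤ a → a ≤ n → z.SameCycle 1 a) : IsNCycleOn n z := by
  have key : ∀ a, z a ≠ a → 1 ≤ a ∧ a ≤ n := by
    intro a ha
    by_contra hc
    exact ha (hfix a (by omega))
  refine ⟨⟨1, hmv 1 le_rfl (by omega), fun a ha => hs a (key a ha).1 (key a ha).2⟩, ?_⟩
  have : {a : ℕ | z a ≠ a} = ((Finset.Icc 1 n : Finset ℕ) : Set ℕ) := by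
    ext a
    simp only [Set.mem_ofPred_eq, Finset.coe_Icc, Set.mem_Icc]
    exact ⟨key a, fun h => hmv a h.1 h.2⟩
  rw [this, Set.ncard_coe_finset]
  simp

theorem cycle_A (n i p e : ℕ) (hn : 4 ≤ n) (hi : 1 ≤ i) (hp : i + 2 ≤ p) (hpn : p + 2 * e = n)
    (z : Equiv.Perm ℕ) (hz : ∀ a, z a = fA n i p a) : IsNCycleOn n z := by
  have up : ∀ a, 1 ≤ a → a ≤ i → z.SameCycle 1 a := by
    intro a h1 h2
    have := chain_up z 1 1 (a - 1) (by
      intro k hk; rw [hz]; have hs := fA_spec n i p (1 + 1 * k); omega)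
    rwa [show 1 + 1 * (a - 1) = a by omega] at this
  have odd : ∀ k, k ≤ e → z.SameCycle (p - 1) (p - 1 + 2 * k) := by
    intro k hk
    refine chain_down z 2 _ _ ?_
    intro k hk; rw [hz]; have hs := fA_spec n i p (p - 1 + 2 * (k + 1)); omega
  have even : ∀ k, k ≤ e → z.SameCycle p (p + 2 * k) := by
    intro k hk
    refine chain_down z 2 _ _ ?_
    intro k hk; rw [hz]; have hs := fA_spec n i p (p + 2 * (k + 1)); omega
  have mid : ∀ a, i + 1 ≤ a → a + 1 ≤ p → z.SameCycle (i + 1) a := by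
    intro a h1 h2
    have := chain_down z 1 (i + 1) (a - (i + 1)) (by
      intro k hk; rw [hz]; have hs := fA_spec n i p (i + 1 + 1 * (k + 1)); omega)
    rwa [show i + 1 + 1 * (a - (i + 1)) = a by omega] at this
  have hp1 : z.SameCycle 1 p :=
    (same_step z p 1 (by rw [hz]; have hs := fA_spec n i p p; omega)).symm
  have hin : z.SameCycle i (p - 1 + 2 * e) :=
    same_step z _ _ (by rw [hz]; have hs := fA_spec n i p i; omega)
  have h1q : z.SameCycle 1 (p - 1) := ((up i hi le_rfl).trans hin).trans (odd e le_rfl).symm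
  have h1i : z.SameCycle 1 (i + 1) := h1q.trans (mid (p - 1) (by omega) (by omega)).symm
  apply isNCycleOn_of n hn
  · intro a ha; rw [hz]; have hs := fA_spec n i p a; omega
  · intro a h1 h2; rw [hz]; have hs := fA_spec n i p a; omega
  · intro a h1 h2
    by_cases c1 : a ≤ i
    · exact up a h1 c1
    by_cases c2 : a + 1 ≤ p
    · exact h1i.trans (mid a (by omega) c2)
    by_cases c3 : ∃ k, a = p + 2 * k
    · obtain ⟨k, rfl⟩ := c3
      exact hp1.trans (even k (by omega))
    · have c4 : a = p - 1 + 2 * ((a - (p - 1)) / 2) := by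
        by_contra hc
        exact c3 ⟨(a - p) / 2, by omega⟩
      rw [c4]
      exact h1q.trans (odd _ (by omega))

theorem cycle_B (n i r e : ℕ) (hn : 4 ≤ n) (hi : 1 ≤ i) (hp : i + 2 ≤ r)
    (hpn : r + 1 + 2 * e = n)
    (z : Equiv.Perm ℕ) (hz : ∀ a, z a = fB n i r a) : IsNCycleOn n z := by
  have up : ∀ a, 1 ≤ a → a ≤ i → z.SameCycle 1 a := by
    intro a h1 h2
    have := chain_up z 1 1 (a - 1) (by
      intro k hk; rw [hz]; have hs := fB_spec n i r (1 + 1 * k); omega)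
    rwa [show 1 + 1 * (a - 1) = a by omega] at this
  have odd : ∀ k, k ≤ e + 1 → z.SameCycle (r - 1) (r - 1 + 2 * k) := by
    intro k hk
    refine chain_down z 2 _ _ ?_
    intro k hk; rw [hz]; have hs := fB_spec n i r (r - 1 + 2 * (k + 1)); omega
  have even : ∀ k, k ≤ e → z.SameCycle r (r + 2 * k) := by
    intro k hk
    refine chain_down z 2 _ _ ?_
    intro k hk; rw [hz]; have hs := fB_spec n i r (r + 2 * (k + 1)); omega
  have mid : ∀ a, i + 1 ≤ a → a + 1 ≤ r → z.SameCycle (i + 1) a := by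
    intro a h1 h2
    have := chain_down z 1 (i + 1) (a - (i + 1)) (by
      intro k hk; rw [hz]; have hs := fB_spec n i r (i + 1 + 1 * (k + 1)); omega)
    rwa [show i + 1 + 1 * (a - (i + 1)) = a by omega] at this
  have h1i : z.SameCycle 1 (i + 1) :=
    (same_step z (i + 1) 1 (by rw [hz]; have hs := fB_spec n i r (i + 1); omega)).symm
  have hin : z.SameCycle i (r + 2 * e) :=
    same_step z _ _ (by rw [hz]; have hs := fB_spec n i r i; omega)
  have h1r : z.SameCycle 1 r := ((up i hi le_rfl).trans hin).trans (even e le_rfl).symm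
  have h1q : z.SameCycle 1 (r - 1) := h1i.trans (mid (r - 1) (by omega) (by omega))
  apply isNCycleOn_of n hn
  · intro a ha; rw [hz]; have hs := fB_spec n i r a; omega
  · intro a h1 h2; rw [hz]; have hs := fB_spec n i r a; omega
  · intro a h1 h2
    by_cases c1 : a ≤ i
    · exact up a h1 c1
    by_cases c2 : a + 1 ≤ r
    · exact h1i.trans (mid a (by omega) c2)
    by_cases c3 : ∃ k, a = r + 2 * k
    · obtain ⟨k, rfl⟩ := c3
      exact h1r.trans (even k (by omega))
    · have c4 : a = r - 1 + 2 * ((a - (r - 1)) / 2) := by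
        by_contra hc
        exact c3 ⟨(a - r) / 2, by omega⟩
      rw [c4]
      exact h1q.trans (odd _ (by omega))

theorem len_A (n i p : ℕ) (hn : 4 ≤ n) (hi : 1 ≤ i) (hp : i + 2 ≤ p) (hpn : p ≤ n)
    (z : Equiv.Perm ℕ) (hz : ∀ a, z a = fA n i p a) :
    coxLen n z = (p - 1) + 2 * (n - i - 2) := by
  have : ((Finset.Icc 1 n ×ˢ Finset.Icc 1 n).filter fun q => q.1 < q.2 ∧ z q.2 < z q.1)
      = (Finset.Icc 1 (p - 1) ×ˢ {p}) ∪
        (Finset.Icc i (i + 1) ×ˢ ((Finset.Icc (i + 2) n).erase p)) := by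
    ext ⟨a, b⟩
    simp only [Finset.mem_filter, Finset.mem_product, Finset.mem_Icc, Finset.mem_union,
      Finset.mem_singleton, Finset.mem_erase, hz]
    have h1 := fA_spec n i p a
    have h2 := fA_spec n i p b
    omega
  unfold coxLen
  rw [this, Finset.card_union_of_disjoint, Finset.card_product, Finset.card_product,
    Finset.card_erase_of_mem]
  · simp only [Nat.card_Icc, Finset.card_singleton]
    rw [show i + 1 + 1 - i = 2 by omega]
    omega
  · simp; omega
  · rw [Finset.disjoint_left]
    rintro ⟨a, b⟩
    simp only [Finset.mem_product, Finset.mem_Icc, Finset.mem_singleton, Finset.mem_erase]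
    omega

theorem len_B (n i r : ℕ) (hn : 4 ≤ n) (hi : 1 ≤ i) (hp : i + 2 ≤ r) (hpn : r + 1 ≤ n)
    (z : Equiv.Perm ℕ) (hz : ∀ a, z a = fB n i r a) :
    coxLen n z = i + (n - i - 2) + (n - r) := by
  have : ((Finset.Icc 1 n ×ˢ Finset.Icc 1 n).filter fun q => q.1 < q.2 ∧ z q.2 < z q.1)
      = ((Finset.Icc 1 i ×ˢ {i + 1}) ∪
        ({i} ×ˢ ((Finset.Icc (i + 2) n).erase r))) ∪ ({r} ×ˢ Finset.Icc (r + 1) n) := by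
    ext ⟨a, b⟩
    simp only [Finset.mem_filter, Finset.mem_product, Finset.mem_Icc, Finset.mem_union,
      Finset.mem_singleton, Finset.mem_erase, hz]
    have h1 := fB_spec n i r a
    have h2 := fB_spec n i r b
    omega
  unfold coxLen
  rw [this, Finset.card_union_of_disjoint, Finset.card_union_of_disjoint, Finset.card_product,
    Finset.card_product, Finset.card_product, Finset.card_erase_of_mem]
  · simp only [Nat.card_Icc, Finset.card_singleton]
    omega
  · simp; omega
  · rw [Finset.disjoint_left]
    rintro ⟨a, b⟩
    simp only [Finset.mem_product, Finset.mem_Icc, Finset.mem_singleton, Finset.mem_erase]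
    omega
  · rw [Finset.disjoint_left]
    rintro ⟨a, b⟩
    simp only [Finset.mem_product, Finset.mem_Icc, Finset.mem_singleton, Finset.mem_erase,
      Finset.mem_union]
    omega

/-- The word `s_k s_{k+1} ⋯ s_{k+m-1}`. -/
theorem asc_spec (k m a : ℕ) :
    (k ≤ a ∧ a < k + m ∧ ((List.range' k m).map simpleRefl).prod a = a + 1) ∨
    (a = k + m ∧ ((List.range' k m).map simpleRefl).prod a = k) ∨
    ((a < k ∨ k + m < a) ∧ ((List.range' k m).map simpleRefl).prod a = a) := by
  induction m generalizing a with
  | zero =>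
    have : ((List.range' k 0).map simpleRefl).prod a = a := by simp
    omega
  | succ m ih =>
    have e : ((List.range' k (m + 1)).map simpleRefl).prod a =
        ((List.range' k m).map simpleRefl).prod (simpleRefl (k + m) a) := by
      rw [List.range'_1_concat]
      simp only [List.map_append, List.prod_append, List.map_cons, List.map_nil, List.prod_cons,
        List.prod_nil, mul_one, Equiv.Perm.mul_apply]
    rw [e]
    have h1 := ih (simpleRefl (k + m) a)
    have h2 := sr_spec (k + m) a
    omega

/-- The word `s_{k+m-1} ⋯ s_{k+1} s_k`. -/
theorem desc_spec (k m a : ℕ) :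
    (k < a ∧ a ≤ k + m ∧ ((List.range' k m).reverse.map simpleRefl).prod a = a - 1) ∨
    (a = k ∧ ((List.range' k m).reverse.map simpleRefl).prod a = k + m) ∨
    ((a < k ∨ k + m < a) ∧ ((List.range' k m).reverse.map simpleRefl).prod a = a) := by
  induction m generalizing a with
  | zero =>
    have : ((List.range' k 0).reverse.map simpleRefl).prod a = a := by simp
    omega
  | succ m ih =>
    have e : ((List.range' k (m + 1)).reverse.map simpleRefl).prod a =
        simpleRefl (k + m) (((List.range' k m).reverse.map simpleRefl).prod a) := by
      rw [List.range'_1_concat]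
      simp only [List.reverse_append, List.reverse_cons, List.reverse_nil, List.nil_append,
        List.singleton_append, List.map_cons, List.prod_cons, Equiv.Perm.mul_apply]
    rw [e]
    have h1 := ih a
    have h2 := sr_spec (k + m) (((List.range' k m).reverse.map simpleRefl).prod a)
    omega

theorem cElt_spec (n a : ℕ) (hn : 4 ≤ n) :
    (a = 1 ∧ cElt n a = n - 1) ∨ (2 ≤ a ∧ a ≤ n - 2 ∧ cElt n a = a - 1) ∨
    (a = n - 1 ∧ cElt n a = n) ∨ (a = n ∧ cElt n a = n - 2) ∨
    ((a = 0 ∨ n < a) ∧ cElt n a = a) := by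
  have e : cElt n a = simpleRefl (n - 2) (simpleRefl (n - 1)
      (((List.range' 1 (n - 3)).reverse.map simpleRefl).prod a)) := by
    unfold cElt
    simp only [List.map_cons, List.prod_cons, Equiv.Perm.mul_apply]
  rw [e]
  have h1 := desc_spec 1 (n - 3) a
  have h2 := sr_spec (n - 1) (((List.range' 1 (n - 3)).reverse.map simpleRefl).prod a)
  have h3 := sr_spec (n - 2) (simpleRefl (n - 1)
      (((List.range' 1 (n - 3)).reverse.map simpleRefl).prod a))
  omega

set_option maxHeartbeats 1000000 in
theorem descElt_spec (n k a : ℕ) (hn : 4 ≤ n) (hk : 2 ≤ k) (hkn : k ≤ n - 1) :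
    (a = 1 ∧ descElt n k a = n - 1) ∨ (2 ≤ a ∧ a < k ∧ descElt n k a = a - 1) ∨
    (a = k ∧ descElt n k a = n) ∨ (k < a ∧ a ≤ n ∧ 4 ≤ a ∧ descElt n k a = a - 2) ∨
    (a = 3 ∧ k = 2 ∧ descElt n k a = 1) ∨ ((a = 0 ∨ n < a) ∧ descElt n k a = a) := by
  have e : descElt n k a =
      cElt n (((List.range' k (n - 1 - k)).reverse.map simpleRefl).prod a) := rfl
  rw [e]
  have h1 := desc_spec k (n - 1 - k) a
  have h2 := cElt_spec n (((List.range' k (n - 1 - k)).reverse.map simpleRefl).prod a) hn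
  omega

theorem desc_cycle (n k e : ℕ) (hn : 4 ≤ n) (hk : 2 ≤ k) (he : k + 1 + 2 * e = n) :
    IsNCycleOn n (descElt n k) := by
  by_cases h2 : k = 2
  · subst h2
    refine cycle_A n 1 3 e hn le_rfl le_rfl (by omega) _ ?_
    intro a
    have h1 := descElt_spec n 2 a hn le_rfl (by omega)
    have h2 := fA_spec n 1 3 a
    omega
  · refine cycle_B n 1 k e hn le_rfl (by omega) (by omega) _ ?_
    intro a
    have h1 := descElt_spec n k a hn hk (by omega)
    have h2 := fB_spec n 1 k a
    omega

/-- The data of one element of the family. -/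
theorem family (n j i : ℕ) (hn : 4 ≤ n) (hj : j ≤ n - 2) (hi : 1 ≤ i) (hij : i ≤ j) :
    ∃ z : Equiv.Perm ℕ, z i = n - 1 ∧
        (∀ a : ℕ, (a = 0 ∨ n < a) → z a = a) ∧ IsNCycleOn n z ∧
        coxLen n z + 2 * j + 5 = 3 * n ∧
        (∀ a, 2 ≤ a → a + 1 ≤ n - 2 → z⁻¹ a < z⁻¹ (a + 1)) ∧
        z⁻¹ (n - 1) < z⁻¹ n := by
  by_cases h : 2 * j + 2 ≤ n + i
  · obtain ⟨z, hz, hz'⟩ := exists_A n i (n - 2 * (j - i)) hn hi (by omega) (by omega)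
    refine ⟨z, ?_, ?_, cycle_A n i _ (j - i) hn hi (by omega) (by omega) z hz, ?_, ?_, ?_⟩
    · rw [hz]; have hs := fA_spec n i (n - 2 * (j - i)) i; omega
    · intro a ha; rw [hz]; have hs := fA_spec n i (n - 2 * (j - i)) a; omega
    · rw [len_A n i _ hn hi (by omega) (by omega) z hz]; omega
    · intro a h1 h2
      rw [hz', hz']; have h3 := gA_spec n i (n - 2 * (j - i)) a; have h4 := gA_spec n i (n - 2 * (j - i)) (a + 1); omega
    · rw [hz', hz']; have h3 := gA_spec n i (n - 2 * (j - i)) (n - 1); have h4 := gA_spec n i (n - 2 * (j - i)) n; omega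
  · obtain ⟨z, hz, hz'⟩ := exists_B n i (2 * j + 3 - n) hn hi (by omega) (by omega)
    refine ⟨z, ?_, ?_, cycle_B n i _ (n - 2 - j) hn hi (by omega) (by omega) z hz, ?_, ?_, ?_⟩
    · rw [hz]; have hs := fB_spec n i (2 * j + 3 - n) i; omega
    · intro a ha; rw [hz]; have hs := fB_spec n i (2 * j + 3 - n) a; omega
    · rw [len_B n i _ hn hi (by omega) (by omega) z hz]; omega
    · intro a h1 h2
      rw [hz', hz']; have h3 := gB_spec n i (2 * j + 3 - n) a; have h4 := gB_spec n i (2 * j + 3 - n) (a + 1); omega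
    · rw [hz', hz']; have h3 := gB_spec n i (2 * j + 3 - n) (n - 1); have h4 := gB_spec n i (2 * j + 3 - n) n; omega

/-- for y ∈ S_n with y⁻¹(2) < ⋯ < y⁻¹(n−2) and y⁻¹(n−1) < y⁻¹(n):
the elements c, c s_{n−2}s_{n−3}, …, c s_{n−2}⋯s_2, c s_{n−2}⋯s_2 s_3s_4, …,
c s_{n−2}⋯s_2 s_3s_4⋯s_{n−1} are all n-cycles (n odd; analogously, with descents down
to s_3 and ascents from s_2, for n even). In particular, for 1 ≤ j ≤ n−2 there are at
least j distinct n-cycles of Coxeter length 3n−2j−5 satisfying these inequalities. -/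
theorem stmt_16 (n : ℕ) (hn : 4 ≤ n)
    (y : Equiv.Perm ℕ) (hyfix : ∀ a : ℕ, (a = 0 ∨ n < a) → y a = a)
    (hy1 : ∀ a, 2 ≤ a → a + 1 ≤ n - 2 → y⁻¹ a < y⁻¹ (a + 1))
    (hy2 : y⁻¹ (n - 1) < y⁻¹ n) :
    (Odd n →
      (∀ t, 2 * t ≤ n - 3 → IsNCycleOn n (descElt n (n - 1 - 2 * t))) ∧
      (∀ u, 1 ≤ u → 2 * u ≤ n - 3 →
        IsNCycleOn n (descElt n 2 * ((List.range' 3 (2 * u)).map simpleRefl).prod))) ∧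
    (Even n →
      (∀ t, 2 * t ≤ n - 4 → IsNCycleOn n (descElt n (n - 1 - 2 * t))) ∧
      (∀ u, 1 ≤ u → 2 * u ≤ n - 2 →
        IsNCycleOn n (descElt n 3 * ((List.range' 2 (2 * u)).map simpleRefl).prod))) ∧
    (∀ j, 1 ≤ j → j ≤ n - 2 →
      ∃ S : Finset (Equiv.Perm ℕ), j ≤ S.card ∧ ∀ z ∈ S,
        (∀ a : ℕ, (a = 0 ∨ n < a) → z a = a) ∧ IsNCycleOn n z ∧
        coxLen n z + 2 * j + 5 = 3 * n ∧
        (∀ a, 2 ≤ a → a + 1 ≤ n - 2 → z⁻¹ a < z⁻¹ (a + 1)) ∧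
        z⁻¹ (n - 1) < z⁻¹ n) := by
  refine ⟨?_, ?_, ?_⟩
  · rintro ⟨m, hm⟩
    refine ⟨?_, ?_⟩
    · intro t ht
      exact desc_cycle n _ t hn (by omega) (by omega)
    · intro u hu1 hu2
      refine cycle_A n 1 (3 + 2 * u) (m - 1 - u) hn le_rfl (by omega) (by omega) _ ?_
      intro a
      rw [Equiv.Perm.mul_apply]
      have h1 := asc_spec 3 (2 * u) a
      have h2 := descElt_spec n 2 (((List.range' 3 (2 * u)).map simpleRefl).prod a) hn
        (by omega) (by omega)
      have h3 := fA_spec n 1 (3 + 2 * u) a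
      omega
  · rintro ⟨m, hm⟩
    refine ⟨?_, ?_⟩
    · intro t ht
      exact desc_cycle n _ t hn (by omega) (by omega)
    · intro u hu1 hu2
      refine cycle_A n 1 (2 + 2 * u) (m - 1 - u) hn le_rfl (by omega) (by omega) _ ?_
      intro a
      rw [Equiv.Perm.mul_apply]
      have h1 := asc_spec 2 (2 * u) a
      have h2 := descElt_spec n 3 (((List.range' 2 (2 * u)).map simpleRefl).prod a) hn
        (by omega) (by omega)
      have h3 := fA_spec n 1 (2 + 2 * u) a
      omega
  · intro j hj1 hj2
    classical
    have hex : ∀ i : ℕ, ∃ z : Equiv.Perm ℕ, 1 ≤ i → i ≤ j → z i = n - 1 ∧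
        (∀ a : ℕ, (a = 0 ∨ n < a) → z a = a) ∧ IsNCycleOn n z ∧
        coxLen n z + 2 * j + 5 = 3 * n ∧
        (∀ a, 2 ≤ a → a + 1 ≤ n - 2 → z⁻¹ a < z⁻¹ (a + 1)) ∧
        z⁻¹ (n - 1) < z⁻¹ n := by
      intro i
      by_cases h : 1 ≤ i ∧ i ≤ j
      · obtain ⟨z, hz⟩ := family n j i hn hj2 h.1 h.2
        exact ⟨z, fun _ _ => hz⟩
      · exact ⟨1, fun h1 h2 => absurd ⟨h1, h2⟩ h⟩
    choose Z hZ using hex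
    refine ⟨(Finset.Icc 1 j).image Z, ?_, ?_⟩
    · rw [Finset.card_image_of_injOn]
      · simp
      · intro a ha b hb hab
        simp only [Finset.coe_Icc, Set.mem_Icc] at ha hb
        have e1 := (hZ a ha.1 ha.2).1
        have e2 := (hZ b hb.1 hb.2).1
        have hab' : Z a = Z b := hab
        rw [← hab', ← e1] at e2
        exact ((Z a).injective e2).symm
    · intro z hz
      simp only [Finset.mem_image, Finset.mem_Icc] at hz
      obtain ⟨i, hi, rfl⟩ := hz
      exact (hZ i hi.1 hi.2).2
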